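/- add(N¹) ≤ add(HDZ), where N¹ = {A ⊆ 2^ω : ℋ¹(A) = 0} is the ideal of subsets of the Cantor space of 1-dimensional Hausdorff measure zero (which coincides with the Lebesgue-null ideal on 2^ω), and HDZ = {A ⊆ 2^ω : dim_H(A) = 0}. -/

import Mathlib

open MeasureTheory Set
open scoped ENNReal

/-- The Cantor space `2^ω = ℕ → Bool` carries the metric
`d(x,y) = 2^{-min{n : x n ≠ y n}}` (and `d(x,x) = 0`). -/
noncomputable local instance cantorMetric : MetricSpace (ℕ → Bool) := PiNat.metricSpace

local instance cantorMeasurable : MeasurableSpace (ℕ → Bool) := borel _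

local instance cantorBorel : BorelSpace (ℕ → Bool) := ⟨rfl⟩

/-- The additivity number of a family `I` of subsets of `X`:
the least cardinality of a subfamily of `I` whose union is not in `I`. -/
noncomputable def idealAdd {X : Type*} (I : Set (Set X)) : Cardinal :=
  sInf {c : Cardinal | ∃ F : Set (Set X), F ⊆ I ∧ ⋃₀ F ∉ I ∧ c = Cardinal.mk F}

/-- The fair coin measure on `κ → Bool`, described by its values on the sets needed below. -/
lemma exists_coin_measure (κ : Type) :
    ∃ ν : Measure (κ → Bool), IsProbabilityMeasure ν ∧
      (∀ (s : Finset κ) (x : κ → Bool), ν {y | ∀ i ∈ s, y i = x i} = 2⁻¹ ^ s.card) ∧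
      ∀ (ι : Type) (S : ι → Finset κ), Pairwise (fun a b => Disjoint (S a) (S b)) →
        ∀ T : Finset ι, ν {y | ∀ e ∈ T, ∃ i ∈ S e, y i = false} =
          ∏ e ∈ T, (1 - 2⁻¹ ^ (S e).card) := by
  classical
  let c : Measure Bool := (PMF.uniformOfFintype Bool).toMeasure
  let ν := Measure.infinitePi (fun _ : κ => c)
  have hcyl (s : Finset κ) (x : κ → Bool) : ν {y | ∀ i ∈ s, y i = x i} = 2⁻¹ ^ s.card := by
    have h : {y : κ → Bool | ∀ i ∈ s, y i = x i} = Set.pi s (fun i => {x i}) := by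
      ext y; simp [Set.mem_pi]
    rw [h, Measure.infinitePi_pi _ (fun _ _ => measurableSet_singleton _)]
    simp [c]
  refine ⟨ν, inferInstance, hcyl, fun ι S hS T => ?_⟩
  let C : ι → Set (κ → Bool) := fun e => {y | ∀ i ∈ S e, y i = true}
  have hC (e : ι) : MeasurableSet (C e) := by
    have h : C e = Set.pi (S e) (fun _ => {true}) := by
      ext y; simp [C, Set.mem_pi]
    rw [h]
    exact MeasurableSet.pi (S e).countable_toSet fun _ _ => measurableSet_singleton _
  have hind : ProbabilityTheory.iIndepSet C ν := by
    rw [ProbabilityTheory.iIndepSet_iff_meas_biInter hC]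
    intro t
    have h : ⋂ i ∈ t, C i = {y | ∀ i ∈ t.biUnion S, y i = (fun _ => true : κ → Bool) i} := by
      ext y
      simp only [C, mem_iInter, mem_ofPred_eq, Finset.mem_biUnion]
      grind
    rw [h, hcyl, Finset.card_biUnion fun a _ b _ hab => hS hab, ← Finset.prod_pow_eq_pow_sum]
    exact Finset.prod_congr rfl fun e _ => (hcyl (S e) fun _ => true).symm
  have h : {y | ∀ e ∈ T, ∃ i ∈ S e, y i = false} = ⋂ e ∈ T, (C e)ᶜ := by
    ext y; simp [C]
  rw [h, ProbabilityTheory.iIndep.meas_biInter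
    ((ProbabilityTheory.iIndepSet_iff_iIndep C ν).1 hind)
    fun e _ => (MeasurableSpace.measurableSet_generateFrom (mem_singleton _)).compl]
  refine Finset.prod_congr rfl fun e _ => ?_
  rw [prob_compl_eq_one_sub (hC e)]
  exact congrArg _ (hcyl (S e) fun _ => true)

/-- Finite binary strings. -/
abbrev BinString : Type := Σ n : ℕ, Fin n → Bool

namespace BinString

/-- The set of points of the Cantor space that extend a given finite string. -/
def cyl (τ : BinString) : Set (ℕ → Bool) := {x | ∀ i : Fin τ.1, x i = τ.2 i}

/-- The initial segment of length `n` of a point of the Cantor space. -/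
def ofPrefix (x : ℕ → Bool) (n : ℕ) : BinString := ⟨n, fun i => x i⟩

lemma cyl_ofPrefix (x : ℕ → Bool) (n : ℕ) : cyl (ofPrefix x n) = PiNat.cylinder x n := by
  ext y
  simp only [cyl, ofPrefix, mem_ofPred_eq, PiNat.mem_cylinder_iff]
  exact ⟨fun h i hi => h ⟨i, hi⟩, fun h i => h i i.2⟩

lemma ediam_cyl_le (τ : BinString) : Metric.ediam τ.cyl ≤ 2⁻¹ ^ τ.1 := by
  refine Metric.ediam_le fun x hx y hy => ?_
  have h : y ∈ PiNat.cylinder x τ.1 := by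
    rw [PiNat.mem_cylinder_iff]
    exact fun i hi => (hy ⟨i, hi⟩).trans (hx ⟨i, hi⟩).symm
  rw [PiNat.mem_cylinder_iff_dist_le, dist_comm] at h
  rw [edist_dist]
  refine (ENNReal.ofReal_le_ofReal h).trans (le_of_eq ?_)
  rw [ENNReal.ofReal_pow (by norm_num), one_div, ENNReal.ofReal_inv_of_pos (by norm_num)]
  simp

/-- Every nonempty set sits in a cylinder that is not much larger than it. -/
lemma exists_subset_cyl {t : Set (ℕ → Bool)} (ht : t.Nonempty) {s : ℝ} (hs : 0 < s)
    {δ : ℝ≥0∞} (hδ : δ ≠ 0) :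
    ∃ τ : BinString, t ⊆ τ.cyl ∧ ((2⁻¹ : ℝ≥0∞) ^ τ.1) ^ s ≤ Metric.ediam t ^ s + δ := by
  obtain ⟨x, hx⟩ := ht
  by_cases h : ∀ n, t ⊆ PiNat.cylinder x n
  · have hlim : Filter.Tendsto (fun n : ℕ => ((2⁻¹ : ℝ≥0∞) ^ n) ^ s) Filter.atTop (nhds 0) := by
      have h1 := ENNReal.tendsto_pow_atTop_nhds_zero_of_lt_one (r := 2⁻¹) (by simp)
      have h2 := h1.ennrpow_const s
      rwa [ENNReal.zero_rpow_of_pos hs] at h2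
    obtain ⟨n, hn⟩ := (hlim.eventually (gt_mem_nhds (pos_iff_ne_zero.2 hδ))).exists
    exact ⟨ofPrefix x n, by rw [cyl_ofPrefix]; exact h n, hn.le.trans le_add_self⟩
  · have hex : ∃ n, ¬ t ⊆ PiNat.cylinder x n := not_forall.1 h
    classical
    obtain ⟨n, hn⟩ : ∃ n, Nat.find hex = n + 1 := by
      refine Nat.exists_eq_succ_of_ne_zero fun h0 => Nat.find_spec hex ?_
      rw [h0, PiNat.cylinder_zero]
      exact subset_univ _
    have hsub : t ⊆ PiNat.cylinder x n := not_not.1 (Nat.find_min hex (m := n) (by omega))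
    obtain ⟨y, hy, hyn⟩ := not_subset.1 (hn ▸ Nat.find_spec hex)
    have hyx : y ≠ x := fun h => hyn (h ▸ PiNat.self_mem_cylinder _ _)
    have hfd : PiNat.firstDiff y x ≤ n := by
      rw [PiNat.mem_cylinder_comm, PiNat.mem_cylinder_iff_le_firstDiff hyx.symm,
        PiNat.firstDiff_comm] at hyn
      omega
    refine ⟨ofPrefix x n, by rwa [cyl_ofPrefix], le_add_right ?_⟩
    refine ENNReal.rpow_le_rpow (le_trans ?_ (Metric.edist_le_ediam_of_mem hy hx)) hs.le
    rw [edist_dist, PiNat.dist_eq_of_ne hyx, ENNReal.ofReal_pow (by norm_num), one_div,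
      ENNReal.ofReal_inv_of_pos (by norm_num), ENNReal.ofReal_ofNat]
    exact pow_le_pow_right_of_le_one' (by simp) hfd

end BinString

lemma hausdorffMeasure_one_univ_le : μH[(1 : ℝ)] (univ : Set (ℕ → Bool)) ≤ 1 := by
  refine (Measure.hausdorffMeasure_le_liminf_sum (ι := fun n : ℕ => Fin n → Bool) 1 univ
    (l := Filter.atTop) (fun n => 2⁻¹ ^ n)
    (ENNReal.tendsto_pow_atTop_nhds_zero_of_lt_one (by simp)) (fun n σ => BinString.cyl ⟨n, σ⟩)
    (.of_forall fun n σ => BinString.ediam_cyl_le _)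
    (.of_forall fun n x _ => mem_iUnion.2 ⟨fun i => x i, fun _ => rfl⟩)).trans ?_
  refine (Filter.liminf_le_liminf (v := fun _ => (1 : ℝ≥0∞)) (.of_forall fun n => ?_)).trans ?_
  · refine (Finset.sum_le_sum (g := fun _ => 2⁻¹ ^ n) fun σ _ => ?_).trans ?_
    · rw [ENNReal.rpow_one]; exact BinString.ediam_cyl_le _
    · simp [← mul_pow, ENNReal.mul_inv_cancel]
  · simp

/-- One-dimensional Hausdorff measure on the Cantor space is the fair coin measure. -/
lemma hausdorffMeasure_one_coin :
    IsProbabilityMeasure (μH[(1 : ℝ)] : Measure (ℕ → Bool)) ∧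
      (∀ (s : Finset ℕ) (x : ℕ → Bool),
        μH[(1 : ℝ)] {y : ℕ → Bool | ∀ i ∈ s, y i = x i} = 2⁻¹ ^ s.card) ∧
      ∀ (ι : Type) (S : ι → Finset ℕ), Pairwise (fun a b => Disjoint (S a) (S b)) →
        ∀ T : Finset ι, μH[(1 : ℝ)] {y : ℕ → Bool | ∀ e ∈ T, ∃ i ∈ S e, y i = false} =
          ∏ e ∈ T, (1 - 2⁻¹ ^ (S e).card) := by
  have h := exists_coin_measure ℕ
  rw [show (MeasurableSpace.pi : MeasurableSpace (ℕ → Bool)) = cantorMeasurable from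
    BorelSpace.measurable_eq] at h
  obtain ⟨ν, hν, hcyl, hind⟩ := h
  have hle : ν ≤ μH[(1 : ℝ)] := by
    refine Measure.le_hausdorffMeasure 1 ν 1 one_pos fun t _ => ?_
    rcases t.eq_empty_or_nonempty with rfl | ht
    · simp
    refine le_of_forall_pos_le_add fun δ hδ => ?_
    obtain ⟨τ, hτ, hle⟩ := BinString.exists_subset_cyl ht one_pos hδ.ne'
    refine le_trans ?_ hle
    have hc : τ.cyl ⊆ {y | ∀ i ∈ Finset.range τ.1, y i =
        (fun i => if h : i < τ.1 then τ.2 ⟨i, h⟩ else false : ℕ → Bool) i} := by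
      intro y hy i hi
      have hi' := Finset.mem_range.1 hi
      simpa [hi'] using hy ⟨i, hi'⟩
    refine (measure_mono (hτ.trans hc)).trans ?_
    rw [hcyl, Finset.card_range, ENNReal.rpow_one]
  have : IsFiniteMeasure (μH[(1 : ℝ)] : Measure (ℕ → Bool)) :=
    ⟨hausdorffMeasure_one_univ_le.trans_lt ENNReal.one_lt_top⟩
  have heq : ν = μH[(1 : ℝ)] :=
    Measure.eq_of_le_of_measure_univ_eq hle
      (le_antisymm (hle _) (hausdorffMeasure_one_univ_le.trans (by simp)))
  rw [← heq]
  exact ⟨hν, hcyl, hind⟩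

lemma exists_almost_upper_bound_of_countable {E I : Type*} [Countable I] (w : E → ℝ≥0∞)
    (W : I → Set E) (hW : ∀ i, ∑' e : W i, w e ≠ ∞) :
    ∃ W' : Set E, ∑' e : W', w e ≠ ∞ ∧ ∀ i, (W i \ W').Finite := by
  obtain ⟨ε, hε, hsum⟩ := ENNReal.exists_pos_sum_of_countable one_ne_zero I
  have h (i : I) : ∃ T : Finset (W i), ∑' e : {e // e ∉ T}, w e < ε i :=
    ((ENNReal.tendsto_tsum_compl_atTop_zero (hW i)).eventually
      (gt_mem_nhds (ENNReal.coe_pos.2 (hε i)))).exists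
  choose T hT using h
  refine ⟨⋃ i, range fun e : {e // e ∉ T i} => (e.1 : E), ?_, fun i => ?_⟩
  · refine ((ENNReal.tsum_iUnion_le_tsum w _).trans (ENNReal.tsum_le_tsum fun i => ?_)).trans_lt
      (hsum.trans ENNReal.one_lt_top) |>.ne
    have hinj : Function.Injective fun e : {e // e ∉ T i} => (e.1 : E) :=
      Subtype.val_injective.comp Subtype.val_injective
    rw [tsum_range w hinj]
    exact (hT i).le
  · refine ((T i).finite_toSet.image Subtype.val).subset fun e he => ?_
    by_contra hne
    refine he.2 (mem_iUnion.2 ⟨i, ⟨⟨⟨e, he.1⟩, fun hmem => hne ⟨_, hmem, rfl⟩⟩, rfl⟩⟩)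

lemma prod_one_sub_mul_one_add_sum_le_one {ι : Type*} (T : Finset ι) (a : ι → ℝ≥0∞)
    (ha : ∀ i, a i ≤ 1) : (∏ i ∈ T, (1 - a i)) * (1 + ∑ i ∈ T, a i) ≤ 1 := by
  classical
  induction T using Finset.induction_on with
  | empty => simp
  | insert i T hi ih =>
    rw [Finset.prod_insert hi, Finset.sum_insert hi]
    set P := ∏ i ∈ T, (1 - a i)
    set c := 1 + ∑ i ∈ T, a i with hc
    have h1 : (1 - a i) * (1 + a i) ≤ 1 := by
      rw [mul_add, mul_one]
      calc (1 - a i) + (1 - a i) * a i ≤ (1 - a i) + 1 * a i := by gcongr; exact tsub_le_self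
        _ = 1 := by rw [one_mul, tsub_add_cancel_of_le (ha i)]
    calc (1 - a i) * P * (1 + (a i + ∑ i ∈ T, a i)) = (1 - a i) * P * (c + 1 * a i) := by
          rw [hc, one_mul]; ring
      _ ≤ (1 - a i) * P * (c + c * a i) := by gcongr; exact le_self_add
      _ = ((1 - a i) * (1 + a i)) * (P * c) := by ring
      _ ≤ 1 * 1 := by gcongr
      _ = 1 := one_mul 1

/-- A family of fewer than `add(N¹)` sets, each of finite total weight, is dominated modulo finite
sets by a single set of finite total weight. -/
lemma exists_almost_upper_bound {E : Type} [Countable E] (p : E → ℕ) (𝒱 : Set (Set E))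
    (h𝒱 : ∀ V ∈ 𝒱, ∑' e : V, (2⁻¹ : ℝ≥0∞) ^ p e ≠ ∞)
    (hcard : Cardinal.mk 𝒱 < idealAdd {A : Set (ℕ → Bool) | μH[(1 : ℝ)] A = 0}) :
    ∃ W : Set E, ∑' e : W, (2⁻¹ : ℝ≥0∞) ^ p e ≠ ∞ ∧ ∀ V ∈ 𝒱, (V \ W).Finite := by
  classical
  obtain ⟨hprob, hcyl, hind⟩ := hausdorffMeasure_one_coin
  set μ : Measure (ℕ → Bool) := μH[(1 : ℝ)]
  obtain ⟨code, hcode⟩ := exists_injective_nat E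
  let S : E → Finset ℕ := fun e => (Finset.range (p e)).image (Nat.pair (code e))
  have hScard (e : E) : (S e).card = p e := by
    rw [Finset.card_image_of_injective, Finset.card_range]
    exact fun a b h => (Nat.pair_eq_pair.1 h).2
  have hSdisj : Pairwise fun a b => Disjoint (S a) (S b) := by
    intro a b hab
    rw [Finset.disjoint_left]
    intro n ha hb
    obtain ⟨i, -, rfl⟩ := Finset.mem_image.1 ha
    obtain ⟨j, -, hj⟩ := Finset.mem_image.1 hb
    exact hab (hcode (Nat.pair_eq_pair.1 hj).1.symm)
  let C : E → Set (ℕ → Bool) := fun e => {x | ∀ i ∈ S e, x i = true}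
  have hCμ (e : E) : μ (C e) = 2⁻¹ ^ p e := by
    rw [← hScard e]; exact hcyl (S e) fun _ => true
  have hCopen (e : E) : IsOpen (C e) := by
    have h : C e = ⋂ i ∈ S e, {x | x i = true} := by ext x; simp [C]
    rw [h]
    exact isOpen_biInter_finset fun i _ => (isOpen_discrete ({true} : Set Bool)).preimage
      (continuous_apply (A := fun _ : ℕ => Bool) i)
  have hsummable (D : Set (ℕ → Bool)) (hD : μ D ≠ 0) :
      ∑' e : {e | Disjoint D (C e)}, (2⁻¹ : ℝ≥0∞) ^ p e ≠ ∞ := by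
    refine ne_top_of_le_ne_top (ENNReal.inv_ne_top.2 hD) 
      (ENNReal.summable.tsum_le_of_sum_le fun T => ?_)
    have hle : μ D ≤ ∏ e ∈ T, (1 - 2⁻¹ ^ p e) := by
      have h := hind _ (fun e : {e | Disjoint D (C e)} => S e)
        (fun a b hab => hSdisj (Subtype.val_injective.ne hab)) T
      simp only [hScard] at h
      rw [← h]
      refine measure_mono fun x hx e _ => ?_
      have := disjoint_left.1 e.2 hx
      simpa [C] using this
    have h1 := prod_one_sub_mul_one_add_sum_le_one T
      (fun e : {e | Disjoint D (C e)} => (2⁻¹ : ℝ≥0∞) ^ p e) fun e => pow_le_one' (by simp) _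
    rw [ENNReal.le_inv_iff_mul_le]
    calc _ ≤ (1 + ∑ e ∈ T, (2⁻¹ : ℝ≥0∞) ^ p e) * ∏ e ∈ T, (1 - 2⁻¹ ^ p e) := by
          gcongr; exact le_add_self
      _ ≤ 1 := by rwa [mul_comm]
  let H : Set E → Set (ℕ → Bool) := fun V => Filter.limsup (fun e : V => C e) Filter.cofinite
  have hnull : μ (⋃₀ (H '' 𝒱)) = 0 := by
    by_contra hne
    refine notMem_of_lt_csInf' (Cardinal.mk_image_le.trans_lt hcard) ⟨H '' 𝒱, ?_, hne, rfl⟩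
    rintro _ ⟨V, hV, rfl⟩
    refine measure_limsup_cofinite_eq_zero ?_
    simpa only [hCμ] using h𝒱 V hV
  obtain ⟨U, hHU, hUo, hU⟩ := Set.exists_isOpen_lt_of_lt (⋃₀ (H '' 𝒱)) 1 (hnull ▸ one_pos)
  let ν := μ.restrict Uᶜ
  let K := ν.support
  have hKU : K ⊆ Uᶜ := Measure.support_restrict_subset.trans
    (inter_subset_left.trans hUo.isClosed_compl.closure_eq.subset)
  have hKne : K.Nonempty := by
    refine Measure.nonempty_support fun h0 => ?_
    rw [Measure.restrict_eq_zero, prob_compl_eq_zero_iff hUo.measurableSet] at h0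
    exact hU.ne h0
  have hKpos (x) (hx : x ∈ K) (O) (hO : O ∈ nhds x) : μ (K ∩ O) ≠ 0 := by
    have h0 := (Measure.mem_support_iff_forall x).1 hx O hO
    refine fun h => h0.ne' (measure_mono_null (t := Kᶜ ∪ K ∩ O) ?_ (measure_union_null ?_ ?_))
    · intro y hy
      by_cases hyK : y ∈ K
      · exact Or.inr ⟨hyK, hy⟩
      · exact Or.inl hyK
    · exact Measure.measure_compl_support
    · exact Measure.absolutelyContinuous_of_le Measure.restrict_le_self h
  have hKc : IsClosed K := Measure.isClosed_support
  have : CompactSpace K := isCompact_iff_compactSpace.1 hKc.isCompact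
  have : Nonempty K := hKne.to_subtype
  have hbaire (V) (hV : V ∈ 𝒱) : ∃ O : Set (ℕ → Bool), IsOpen O ∧ (K ∩ O).Nonempty ∧
      ∃ T : Finset E, ∀ e ∈ V, e ∉ T → Disjoint (K ∩ O) (C e) := by
    let f : Finset E → Set K := fun T => {x | ∀ e ∈ V, e ∉ T → (x : ℕ → Bool) ∉ C e}
    have hfc (T) : IsClosed (f T) := by
      simp only [f, ofPred_forall]
      exact isClosed_iInter fun e => isClosed_iInter fun _ => isClosed_iInter fun _ =>
        ((hCopen e).preimage continuous_subtype_val).isClosed_compl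
    have hfU : ⋃ T, f T = univ := by
      refine eq_univ_of_forall fun x => ?_
      have hxH : (x : ℕ → Bool) ∉ H V := fun hx =>
        hKU x.2 (hHU (mem_sUnion_of_mem hx (mem_image_of_mem H hV)))
      have hfin : {e : V | (x : ℕ → Bool) ∈ C e}.Finite := by
        simpa [H, Filter.mem_limsup_iff_frequently_mem, Filter.not_frequently,
          Filter.eventually_cofinite] using hxH
      refine mem_iUnion.2 ⟨(hfin.image Subtype.val).toFinset, fun e he hne hx => hne ?_⟩
      simpa using ⟨hx, he⟩
    obtain ⟨T, x, hx⟩ := nonempty_interior_of_iUnion_of_closed hfc hfU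
    obtain ⟨O', hO'f, hO', hxO'⟩ := mem_interior.1 hx
    obtain ⟨O, hO, rfl⟩ := isOpen_induced_iff.1 hO'
    refine ⟨O, hO, ⟨x, x.2, hxO'⟩, T, fun e he heT => disjoint_left.2 fun y hy => ?_⟩
    exact hO'f (a := ⟨y, hy.1⟩) hy.2 e he heT
  let B := TopologicalSpace.countableBasis (ℕ → Bool)
  let I := {b : B // μ (K ∩ b) ≠ 0}
  have : Countable B := (TopologicalSpace.countable_countableBasis _).to_subtype
  obtain ⟨W, hW, hWI⟩ := exists_almost_upper_bound_of_countable (fun e => (2⁻¹ : ℝ≥0∞) ^ p e)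
    (fun b : I => {e | Disjoint (K ∩ b.1) (C e)}) fun b => hsummable _ b.2
  refine ⟨W, hW, fun V hV => ?_⟩
  obtain ⟨O, hO, ⟨x, hxK, hxO⟩, T, hT⟩ := hbaire V hV
  obtain ⟨b, hb, hxb, hbO⟩ :=
    (TopologicalSpace.isBasis_countableBasis (ℕ → Bool)).exists_subset_of_mem_open hxO hO
  have hbI : μ (K ∩ b) ≠ 0 :=
    hKpos x hxK b ((TopologicalSpace.isOpen_of_mem_countableBasis hb).mem_nhds hxb)
  refine ((hWI ⟨⟨b, hb⟩, hbI⟩).union T.finite_toSet).subset fun e he => ?_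
  by_cases heT : e ∈ T
  · exact Or.inr heT
  · exact Or.inl ⟨(hT e he.1 heT).mono_left (inter_subset_inter_right _ hbO), he.2⟩

lemma exists_cyl_cover {A : Set (ℕ → Bool)} {s : ℝ} (hs : 0 < s) (hA : μH[s] A = 0) {ε : ℝ≥0∞}
    (hε : ε ≠ 0) : ∃ V : Set BinString, A ⊆ ⋃ τ ∈ V, τ.cyl ∧
      ∑' τ : V, ((2⁻¹ : ℝ≥0∞) ^ τ.1.1) ^ s ≤ ε := by
  have hε2 : ε / 2 ≠ 0 := (ENNReal.half_pos hε).ne'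
  have h := hA.trans_lt (pos_iff_ne_zero.2 hε2)
  rw [Measure.hausdorffMeasure_apply] at h
  have h' := (le_iSup₂ (α := ℝ≥0∞) 1 one_pos).trans_lt h
  simp only [iInf_lt_iff] at h'
  obtain ⟨t, hAt, -, ht⟩ := h'
  obtain ⟨δ, hδ, hδsum⟩ := ENNReal.exists_pos_sum_of_countable hε2 ℕ
  have hτ (n : {n // (t n).Nonempty}) :=
    BinString.exists_subset_cyl n.2 hs (ENNReal.coe_ne_zero.2 (hδ n).ne')
  choose τ hsub hle using hτ
  refine ⟨range τ, fun x hx => ?_, ?_⟩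
  · obtain ⟨n, hn⟩ := mem_iUnion.1 (hAt hx)
    exact mem_iUnion₂.2 ⟨τ ⟨n, x, hn⟩, mem_range_self _, hsub ⟨n, x, hn⟩ hn⟩
  · calc ∑' σ : range τ, ((2⁻¹ : ℝ≥0∞) ^ σ.1.1) ^ s
        ≤ ∑' n, ((2⁻¹ : ℝ≥0∞) ^ (τ n).1) ^ s :=
          ENNReal.tsum_le_tsum_comp_of_surjective rangeFactorization_surjective
            fun σ : range τ => ((2⁻¹ : ℝ≥0∞) ^ σ.1.1) ^ s
      _ ≤ ∑' n : {n // (t n).Nonempty}, ((⨆ _ : (t n).Nonempty, Metric.ediam (t n) ^ s) + δ n) :=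
          ENNReal.tsum_le_tsum fun n => (hle n).trans (by simp [n.2])
      _ ≤ ∑' n, ((⨆ _ : (t n).Nonempty, Metric.ediam (t n) ^ s) + δ n) :=
          ENNReal.tsum_comp_le_tsum_of_injective Subtype.val_injective _
      _ ≤ ε / 2 + ε / 2 := by
          rw [ENNReal.tsum_add]
          exact add_le_add ht.le hδsum.le
      _ = ε := ENNReal.add_halves ε

lemma half_pow_div_le (n k : ℕ) :
    (2⁻¹ : ℝ≥0∞) ^ (n / (k + 1)) ≤ 2 * ((2⁻¹ : ℝ≥0∞) ^ n) ^ ((k + 1 : ℝ)⁻¹) := by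
  have hmul : (2 : ℝ≥0∞) * 2⁻¹ = 1 := ENNReal.mul_inv_cancel (by simp) (by simp)
  have hn : n ≤ (k + 1) * (n / (k + 1) + 1) := by
    have h1 := Nat.div_add_mod n (k + 1)
    have h2 := Nat.mod_lt n (Nat.add_pos_right k one_pos)
    rw [mul_add]
    omega
  calc (2⁻¹ : ℝ≥0∞) ^ (n / (k + 1))
      = 2 * ((2⁻¹ : ℝ≥0∞) ^ ((k + 1) * (n / (k + 1) + 1))) ^ ((k + 1 : ℝ)⁻¹) := by
        rw [mul_comm (k + 1), pow_mul, ← ENNReal.rpow_natCast (_ ^ _) (k + 1), ← ENNReal.rpow_mul,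
          Nat.cast_add_one, mul_inv_cancel₀ (by positivity), ENNReal.rpow_one, pow_succ',
          ← mul_assoc, hmul, one_mul]
    _ ≤ _ := by
        gcongr 2 * ?_ ^ _
        exact pow_le_pow_right_of_le_one' (by simp) hn

lemma half_pow_rpow_le_half_pow_div (n k : ℕ) {s : ℝ} (hs : (k + 1 : ℝ)⁻¹ ≤ s) :
    ((2⁻¹ : ℝ≥0∞) ^ n) ^ s ≤ 2⁻¹ ^ (n / (k + 1)) := by
  have hmul : (k + 1) * (n / (k + 1)) ≤ n := Nat.mul_div_le n (k + 1)
  calc ((2⁻¹ : ℝ≥0∞) ^ n) ^ s ≤ ((2⁻¹ : ℝ≥0∞) ^ n) ^ ((k + 1 : ℝ)⁻¹) :=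
        ENNReal.rpow_le_rpow_of_exponent_ge (pow_le_one' (by simp) _) hs
    _ ≤ ((2⁻¹ : ℝ≥0∞) ^ ((k + 1) * (n / (k + 1)))) ^ ((k + 1 : ℝ)⁻¹) := by
        gcongr ?_ ^ _
        exact pow_le_pow_right_of_le_one' (by simp) hmul
    _ = 2⁻¹ ^ (n / (k + 1)) := by
        rw [mul_comm (k + 1), pow_mul, ← ENNReal.rpow_natCast (_ ^ _) (k + 1), ← ENNReal.rpow_mul,
          Nat.cast_add_one, mul_inv_cancel₀ (by positivity), ENNReal.rpow_one]

/-- A set of Hausdorff dimension zero has, for each `k`, a cover by cylinders such that the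
`1 / (k + 1)`-dimensional sizes of all these covers together have finite sum. -/
lemma exists_summable_covers_of_dimH_eq_zero {A : Set (ℕ → Bool)} (hA : dimH A = 0) :
    ∃ V : Set (ℕ × BinString), ∑' e : V, (2⁻¹ : ℝ≥0∞) ^ (e.1.2.1 / (e.1.1 + 1)) ≠ ∞ ∧
      ∀ k, A ⊆ ⋃ τ ∈ {τ | (k, τ) ∈ V}, BinString.cyl τ := by
  obtain ⟨ε, hε, hsum⟩ := ENNReal.exists_pos_sum_of_countable one_ne_zero ℕ
  have h (k : ℕ) : μH[(k + 1 : ℝ)⁻¹] A = 0 := by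
    have h0 : dimH A < ((k + 1 : NNReal)⁻¹ : NNReal) := by
      rw [hA]; exact ENNReal.coe_pos.2 (by positivity)
    simpa using hausdorffMeasure_of_dimH_lt h0
  have hV (k : ℕ) := exists_cyl_cover (by positivity) (h k) (ENNReal.coe_ne_zero.2 (hε k).ne')
  choose V hcov hle using hV
  refine ⟨⋃ k, Prod.mk k '' V k, ?_, fun k x hx => ?_⟩
  · refine ((ENNReal.tsum_iUnion_le_tsum
      (fun e : ℕ × BinString => (2⁻¹ : ℝ≥0∞) ^ (e.2.1 / (e.1 + 1))) _).trans
        (ENNReal.tsum_le_tsum (g := fun k => 2 * (ε k : ℝ≥0∞)) fun k => ?_)).trans_lt ?_ |>.ne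
    · rw [tsum_image (fun e : ℕ × BinString => (2⁻¹ : ℝ≥0∞) ^ (e.2.1 / (e.1 + 1)))
        (Prod.mk_right_injective k).injOn]
      refine (ENNReal.tsum_le_tsum fun τ => half_pow_div_le _ k).trans ?_
      rw [ENNReal.tsum_mul_left]
      gcongr
      exact hle k
    · rw [ENNReal.tsum_mul_left]
      exact ENNReal.mul_lt_top (by simp) (hsum.trans ENNReal.one_lt_top)
  · obtain ⟨τ, hτ, hxτ⟩ := mem_iUnion₂.1 (hcov k hx)
    exact mem_iUnion₂.2 ⟨τ, mem_iUnion.2 ⟨k, mem_image_of_mem _ hτ⟩, hxτ⟩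

/-- A set with cylinder covers as above, for all large `k`, has Hausdorff dimension zero. -/
lemma dimH_eq_zero_of_summable_covers {W : Set (ℕ × BinString)}
    (hW : ∑' e : W, (2⁻¹ : ℝ≥0∞) ^ (e.1.2.1 / (e.1.1 + 1)) ≠ ∞) {A : Set (ℕ → Bool)}
    (hA : ∀ x ∈ A, ∀ᶠ k in Filter.atTop, x ∈ ⋃ τ ∈ {τ | (k, τ) ∈ W}, BinString.cyl τ) :
    dimH A = 0 := by
  let a : ℕ → ℝ≥0∞ := fun k => ∑' τ : {τ | (k, τ) ∈ W}, 2⁻¹ ^ (τ.1.1 / (k + 1))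
  have ha : Filter.Tendsto a Filter.atTop (nhds 0) := by
    refine ENNReal.tendsto_atTop_zero_of_tsum_ne_top (ne_top_of_le_ne_top hW ?_)
    rw [← ENNReal.tsum_sigma (fun k (τ : {τ | (k, τ) ∈ W}) => (2⁻¹ : ℝ≥0∞) ^ (τ.1.1 / (k + 1)))]
    refine ENNReal.tsum_comp_le_tsum_of_injective
      (f := fun e : Σ k, {τ | (k, τ) ∈ W} => (⟨(e.1, e.2.1), e.2.2⟩ : W)) ?_
      (fun e : W => (2⁻¹ : ℝ≥0∞) ^ (e.1.2.1 / (e.1.1 + 1)))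
    rintro ⟨k, τ, h⟩ ⟨l, σ, h'⟩ heq
    simp only [Subtype.mk.injEq, Prod.mk.injEq] at heq
    obtain ⟨rfl, rfl⟩ := heq
    rfl
  let Z : ℕ → Set (ℕ → Bool) := fun m =>
    {x | ∀ k ≥ m, x ∈ ⋃ τ ∈ {τ | (k, τ) ∈ W}, BinString.cyl τ}
  have hAZ : A ⊆ ⋃ m, Z m := fun x hx =>
    mem_iUnion.2 (Filter.eventually_atTop.1 (hA x hx))
  refine nonpos_iff_eq_zero.1 ((dimH_mono hAZ).trans ?_)
  rw [dimH_iUnion]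
  refine iSup_le fun m => le_of_forall_gt fun c hc => ?_
  obtain ⟨s, hs, hsc⟩ := ENNReal.lt_iff_exists_nnreal_btwn.1 hc
  have hs : 0 < s := ENNReal.coe_pos.1 hs
  refine (dimH_le_of_hausdorffMeasure_ne_top (d := s) ?_).trans_lt hsc
  have hle := Measure.hausdorffMeasure_le_liminf_tsum (ι := fun k => {τ | (k, τ) ∈ W}) s (Z m) a ha
    (fun k τ => BinString.cyl τ) (.of_forall fun k τ => ?_)
    (Filter.eventually_atTop.2 ⟨m, fun k hk x hx => ?_⟩)
  · refine ne_top_of_le_ne_top ENNReal.zero_ne_top (hle.trans ?_)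
    rw [← ha.liminf_eq]
    refine Filter.liminf_le_liminf ?_
    obtain ⟨N, hN⟩ := exists_nat_gt ((s : ℝ)⁻¹)
    filter_upwards [Filter.eventually_ge_atTop N] with k hk
    refine ENNReal.tsum_le_tsum fun τ => (ENNReal.rpow_le_rpow (BinString.ediam_cyl_le _) s.2).trans
      (half_pow_rpow_le_half_pow_div _ _ ?_)
    have hs' : (0 : ℝ) < s := hs
    have : (N : ℝ) ≤ k := by exact_mod_cast hk
    exact inv_le_of_inv_le₀ hs' (hN.le.trans (this.trans (by linarith)))
  · refine (BinString.ediam_cyl_le _).trans (le_trans ?_ (ENNReal.le_tsum τ))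
    exact pow_le_pow_right_of_le_one' (by simp) (Nat.div_le_self _ _)
  · simpa using hx k hk

lemma dimH_univ_cantor_ne_zero : dimH (univ : Set (ℕ → Bool)) ≠ 0 := by
  obtain ⟨hprob, -⟩ := hausdorffMeasure_one_coin
  intro h
  have h0 := hausdorffMeasure_of_dimH_lt (d := 1) (h.trans_lt (by simp))
  simp at h0

/-- `add(N¹) ≤ add(HDZ)`, where
`N¹ = {A ⊆ 2^ω : ℋ¹(A) = 0}` and `HDZ = {A ⊆ 2^ω : dim_H(A) = 0}`. -/
theorem stmt17 :
    idealAdd {A : Set (ℕ → Bool) | μH[(1 : ℝ)] A = 0} ≤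
      idealAdd {A : Set (ℕ → Bool) | dimH A = 0} := by
  refine le_csInf ⟨_, {A | dimH A = 0}, subset_rfl, fun h => dimH_univ_cantor_ne_zero ?_, rfl⟩ ?_
  · refine le_antisymm ((dimH_mono fun x _ => ?_).trans_eq h) zero_le
    exact mem_sUnion_of_mem (mem_singleton x) (dimH_singleton x)
  rintro _ ⟨F, hF, hFU, rfl⟩
  by_contra! hlt
  choose! V hVsum hVcov using fun A (hA : A ∈ F) => exists_summable_covers_of_dimH_eq_zero (hF hA)
  obtain ⟨W, hW, hVW⟩ := exists_almost_upper_bound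
    (fun e : ℕ × BinString => e.2.1 / (e.1 + 1)) (V '' F)
    (forall_mem_image.2 hVsum) (Cardinal.mk_image_le.trans_lt hlt)
  refine hFU (dimH_eq_zero_of_summable_covers hW ?_)
  rintro x ⟨A, hA, hx⟩
  have hfin : (Prod.fst '' (V A \ W)).Finite := (hVW _ (mem_image_of_mem V hA)).image _
  filter_upwards [Nat.cofinite_eq_atTop ▸ hfin.compl_mem_cofinite] with k hk
  obtain ⟨τ, hτ, hxτ⟩ := mem_iUnion₂.1 (hVcov A hA k hx)
  refine mem_iUnion₂.2 ⟨τ, ?_, hxτ⟩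
  by_contra hτW
  exact hk ⟨(k, τ), ⟨hτ, hτW⟩, rfl⟩
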